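/- arXiv:2506.18700 — 2 statements merged into one kernel-verified Lean document; each statement's English description precedes it below -/
import Mathlib

section
/- In Mat_P(ℂ) the identity q·F−·L − L·F− − L·F0 + (q−1)^{−1}·(q^{n/2+1}·K1^{−1}·K2 − q^{k/2+1}·K1 − q^{(n−k)/2+1}·K2 + I)·L = 0 holds. -/
open scoped Classical

noncomputable section

variable {F V : Type} [Field F] [AddCommGroup V] [Module F V]

/-- `v` covers `u` in the projective geometry `P`. -/
def Covers (u v : Submodule F V) : Prop :=
  u ≤ v ∧ Module.finrank F ↥v = Module.finrank F ↥u + 1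

/-- `v` slash-covers `u` (relative to the fixed subspace `y`). -/
def SlashCovers (y u v : Submodule F V) : Prop :=
  Covers u v ∧ Module.finrank F ↥(v ⊓ y) = Module.finrank F ↥(u ⊓ y) + 1

/-- `v` backslash-covers `u` (relative to the fixed subspace `y`). -/
def BackslashCovers (y u v : Submodule F V) : Prop :=
  Covers u v ∧ Module.finrank F ↥(v ⊓ y) = Module.finrank F ↥(u ⊓ y)

/-- `q` raised to a real exponent, as a complex number. -/
def qpow (q : ℕ) (e : ℝ) : ℂ := (((q : ℝ) ^ e : ℝ) : ℂ)

/-- The Gaussian bracket `[m] = (q^m - 1)/(q - 1)` as a rational number. -/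
def gaussQ (q m : ℕ) : ℚ := ((q : ℚ) ^ m - 1) / ((q : ℚ) - 1)

/-- The Gaussian bracket `[m] = (q^m - 1)/(q - 1)` as a complex number. -/
def gaussC (q m : ℕ) : ℂ := ((q : ℂ) ^ m - 1) / ((q : ℂ) - 1)

/-- The diagonal matrix `K1`; the `(u,u)` entry is `q^(k/2 - i)` for `u ∈ P_{i,j}`. -/
def matK1 (q k : ℕ) (y : Submodule F V) : Matrix (Submodule F V) (Submodule F V) ℂ :=
  Matrix.diagonal fun u => qpow q ((k : ℝ) / 2 - (Module.finrank F ↥(u ⊓ y) : ℝ))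

/-- The diagonal matrix `K2`; the `(u,u)` entry is `q^(j - (n-k)/2)` for `u ∈ P_{i,j}`. -/
def matK2 (q n k : ℕ) (y : Submodule F V) : Matrix (Submodule F V) (Submodule F V) ℂ :=
  Matrix.diagonal fun u =>
    qpow q (((Module.finrank F ↥u : ℝ) - (Module.finrank F ↥(u ⊓ y) : ℝ))
      - ((n : ℝ) - (k : ℝ)) / 2)

/-- The 0-1 matrix `L1`; the `(u,v)` entry is `1` iff `v` slash-covers `u`. -/
def matL1 (y : Submodule F V) : Matrix (Submodule F V) (Submodule F V) ℂ :=
  Matrix.of fun u v => if SlashCovers y u v then (1 : ℂ) else 0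

/-- The 0-1 matrix `L2`; the `(u,v)` entry is `1` iff `v` backslash-covers `u`. -/
def matL2 (y : Submodule F V) : Matrix (Submodule F V) (Submodule F V) ℂ :=
  Matrix.of fun u v => if BackslashCovers y u v then (1 : ℂ) else 0

/-- `R1 = L1ᵀ`. -/
def matR1 (y : Submodule F V) : Matrix (Submodule F V) (Submodule F V) ℂ := Matrix.transpose (matL1 y)

/-- `R2 = L2ᵀ`. -/
def matR2 (y : Submodule F V) : Matrix (Submodule F V) (Submodule F V) ℂ := Matrix.transpose (matL2 y)

/-- `R = L1 · R2`. -/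
def matR [Fintype (Submodule F V)] (y : Submodule F V) :
    Matrix (Submodule F V) (Submodule F V) ℂ := matL1 y * matR2 y

/-- `L = R1 · L2`. -/
def matL [Fintype (Submodule F V)] (y : Submodule F V) :
    Matrix (Submodule F V) (Submodule F V) ℂ := matR1 y * matL2 y

/-- The 0-1 matrix `F0`. -/
def matF0 (y : Submodule F V) : Matrix (Submodule F V) (Submodule F V) ℂ :=
  Matrix.of fun u v =>
    if SlashCovers y u (u ⊔ v) ∧ SlashCovers y v (u ⊔ v) ∧
        BackslashCovers y (u ⊓ v) u ∧ BackslashCovers y (u ⊓ v) v then (1 : ℂ) else 0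

/-- The 0-1 matrix `F+`. -/
def matFp (y : Submodule F V) : Matrix (Submodule F V) (Submodule F V) ℂ :=
  Matrix.of fun u v =>
    if BackslashCovers y u (u ⊔ v) ∧ BackslashCovers y v (u ⊔ v) then (1 : ℂ) else 0

/-- The 0-1 matrix `F-`. -/
def matFm (y : Submodule F V) : Matrix (Submodule F V) (Submodule F V) ℂ :=
  Matrix.of fun u v =>
    if SlashCovers y (u ⊓ v) u ∧ SlashCovers y (u ⊓ v) v then (1 : ℂ) else 0

/-- The vertex set `X` of the Grassmann graph: `k`-dimensional subspaces of `V`. -/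
abbrev GrassVertex (F V : Type) [Field F] [AddCommGroup V] [Module F V] (k : ℕ) :=
  {z : Submodule F V // Module.finrank F ↥z = k}

/-- The Grassmann graph `J_q(n,k)`: vertices are adjacent iff their intersection
has dimension `k - 1`. -/
def Grass (F V : Type) [Field F] [AddCommGroup V] [Module F V] (k : ℕ) :
    SimpleGraph (GrassVertex F V k) :=
  SimpleGraph.fromRel fun a b => Module.finrank F ↥(a.1 ⊓ b.1) = k - 1

/-- `B_xy = {z ∈ Γ(x) : ∂(z,y) = ∂(x,y) + 1}`. -/
def Bset {k : ℕ} (x y : GrassVertex F V k) : Set (GrassVertex F V k) :=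
  {z | (Grass F V k).Adj x z ∧ (Grass F V k).dist z y = (Grass F V k).dist x y + 1}

/-- `C_xy = {z ∈ Γ(x) : ∂(z,y) = ∂(x,y) - 1}`. -/
def Cset {k : ℕ} (x y : GrassVertex F V k) : Set (GrassVertex F V k) :=
  {z | (Grass F V k).Adj x z ∧ (Grass F V k).dist z y = (Grass F V k).dist x y - 1}

/-- `A_xy = {z ∈ Γ(x) : ∂(z,y) = ∂(x,y)}`. -/
def Aset {k : ℕ} (x y : GrassVertex F V k) : Set (GrassVertex F V k) :=
  {z | (Grass F V k).Adj x z ∧ (Grass F V k).dist z y = (Grass F V k).dist x y}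

/-- `A0_xy`. -/
def A0set {k : ℕ} (x y : GrassVertex F V k) : Set (GrassVertex F V k) :=
  {z | (Grass F V k).Adj x z ∧
    SlashCovers y.1 z.1 (z.1 ⊔ x.1) ∧ SlashCovers y.1 x.1 (z.1 ⊔ x.1) ∧
    BackslashCovers y.1 (z.1 ⊓ x.1) z.1 ∧ BackslashCovers y.1 (z.1 ⊓ x.1) x.1}

/-- `A+_xy`. -/
def Apset {k : ℕ} (x y : GrassVertex F V k) : Set (GrassVertex F V k) :=
  {z | (Grass F V k).Adj x z ∧
    BackslashCovers y.1 z.1 (z.1 ⊔ x.1) ∧ BackslashCovers y.1 x.1 (z.1 ⊔ x.1)}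

/-- `A-_xy`. -/
def Amset {k : ℕ} (x y : GrassVertex F V k) : Set (GrassVertex F V k) :=
  {z | (Grass F V k).Adj x z ∧
    SlashCovers y.1 (z.1 ⊓ x.1) z.1 ∧ SlashCovers y.1 (z.1 ⊓ x.1) x.1}

/-- The edge `wz` has type `0`. -/
def EdgeType0 {k : ℕ} (y w z : GrassVertex F V k) : Prop :=
  SlashCovers y.1 w.1 (w.1 ⊔ z.1) ∧ SlashCovers y.1 z.1 (w.1 ⊔ z.1) ∧
  BackslashCovers y.1 (w.1 ⊓ z.1) w.1 ∧ BackslashCovers y.1 (w.1 ⊓ z.1) z.1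

/-- The edge `wz` has type `+`. -/
def EdgeTypeP {k : ℕ} (y w z : GrassVertex F V k) : Prop :=
  BackslashCovers y.1 w.1 (w.1 ⊔ z.1) ∧ BackslashCovers y.1 z.1 (w.1 ⊔ z.1)

/-- The edge `wz` has type `-`. -/
def EdgeTypeM {k : ℕ} (y w z : GrassVertex F V k) : Prop :=
  SlashCovers y.1 (w.1 ⊓ z.1) w.1 ∧ SlashCovers y.1 (w.1 ⊓ z.1) z.1

theorem finrank_inf_le_of_covers [FiniteDimensional F V] (y : Submodule F V)
    {u v : Submodule F V} (h : Covers u v) :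
    Module.finrank F ↥(v ⊓ y) ≤ Module.finrank F ↥(u ⊓ y) + 1 := by
  have h1 := Submodule.finrank_sup_add_finrank_inf_eq u (v ⊓ y)
  have h2 : u ⊓ (v ⊓ y) = u ⊓ y := by rw [← inf_assoc, inf_eq_left.2 h.1]
  have h3 : Module.finrank F ↥(u ⊔ v ⊓ y) ≤ Module.finrank F ↥v :=
    Submodule.finrank_mono (sup_le h.1 inf_le_left)
  rw [h2] at h1
  have := h.2
  omega

theorem finrank_inf_le_of_le [FiniteDimensional F V] (y : Submodule F V)
    {u v : Submodule F V} (h : u ≤ v) :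
    Module.finrank F ↥(u ⊓ y) ≤ Module.finrank F ↥(v ⊓ y) :=
  Submodule.finrank_mono (inf_le_inf_right y h)

theorem Covers.eq_inf [FiniteDimensional F V] {u v w : Submodule F V} (hne : u ≠ v)
    (hu : Covers w u) (hv : Covers w v) : w = u ⊓ v := by
  have hle : w ≤ u ⊓ v := le_inf hu.1 hv.1
  refine Submodule.eq_of_le_of_finrank_le hle ?_
  by_contra! hlt
  have h1 : u ⊓ v = u := Submodule.eq_of_le_of_finrank_le inf_le_left (by have := hu.2; omega)
  have h2 : u ⊓ v = v := Submodule.eq_of_le_of_finrank_le inf_le_right (by have := hv.2; omega)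
  exact hne (h1.symm.trans h2)

theorem Covers.eq_sup [FiniteDimensional F V] {u v w : Submodule F V} (hne : u ≠ v)
    (hu : Covers u w) (hv : Covers v w) : w = u ⊔ v := by
  have hle : u ⊔ v ≤ w := sup_le hu.1 hv.1
  refine (Submodule.eq_of_le_of_finrank_le hle ?_).symm
  by_contra! hlt
  have h1 : u = u ⊔ v := Submodule.eq_of_le_of_finrank_le le_sup_left (by have := hu.2; omega)
  have h2 : v = u ⊔ v := Submodule.eq_of_le_of_finrank_le le_sup_right (by have := hv.2; omega)
  exact hne (h1.trans h2.symm)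

theorem finrank_inf_inf_add_le [FiniteDimensional F V] (y u v : Submodule F V) :
    Module.finrank F ↥(u ⊓ y) + Module.finrank F ↥(v ⊓ y) ≤
      Module.finrank F ↥((u ⊔ v) ⊓ y) + Module.finrank F ↥((u ⊓ v) ⊓ y) := by
  have h := Submodule.finrank_sup_add_finrank_inf_eq (u ⊓ y) (v ⊓ y)
  rw [← inf_inf_distrib_right] at h
  have h2 : Module.finrank F ↥(u ⊓ y ⊔ v ⊓ y) ≤ Module.finrank F ↥((u ⊔ v) ⊓ y) :=
    Submodule.finrank_mono (sup_le (inf_le_inf_right _ le_sup_left)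
      (inf_le_inf_right _ le_sup_right))
  omega

theorem slash_inf_and_backslash_inf_iff [FiniteDimensional F V] (y u v : Submodule F V) :
    (SlashCovers y (u ⊓ v) u ∧ BackslashCovers y (u ⊓ v) v) ↔
      (BackslashCovers y u (u ⊔ v) ∧ SlashCovers y v (u ⊔ v)) := by
  have hm := Submodule.finrank_sup_add_finrank_inf_eq u v
  have hs := finrank_inf_inf_add_le y u v
  have h1 := finrank_inf_le_of_le y (le_sup_left : u ≤ u ⊔ v)
  have h2 := finrank_inf_le_of_le y (inf_le_right : u ⊓ v ≤ v)
  constructor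
  · rintro ⟨⟨⟨_, a⟩, b⟩, ⟨⟨_, c⟩, d⟩⟩
    have hc : Covers v (u ⊔ v) := ⟨le_sup_right, by omega⟩
    have := finrank_inf_le_of_covers y hc
    exact ⟨⟨⟨le_sup_left, by omega⟩, by omega⟩, hc, by omega⟩
  · rintro ⟨⟨⟨_, a⟩, b⟩, ⟨⟨_, c⟩, d⟩⟩
    exact ⟨⟨⟨inf_le_left, by omega⟩, by omega⟩, ⟨inf_le_right, by omega⟩, by omega⟩

theorem slash_sup_iff [FiniteDimensional F V] (y u v : Submodule F V) :
    (SlashCovers y u (u ⊔ v) ∧ SlashCovers y v (u ⊔ v)) ↔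
      (SlashCovers y (u ⊓ v) u ∧ SlashCovers y (u ⊓ v) v) ∨
      (SlashCovers y u (u ⊔ v) ∧ SlashCovers y v (u ⊔ v) ∧
        BackslashCovers y (u ⊓ v) u ∧ BackslashCovers y (u ⊓ v) v) := by
  have hm := Submodule.finrank_sup_add_finrank_inf_eq u v
  have hs := finrank_inf_inf_add_le y u v
  constructor
  · rintro ⟨⟨⟨x, a⟩, b⟩, ⟨⟨x', c⟩, d⟩⟩
    have hu : Covers (u ⊓ v) u := ⟨inf_le_left, by omega⟩
    have hv : Covers (u ⊓ v) v := ⟨inf_le_right, by omega⟩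
    have h1 := finrank_inf_le_of_covers y hu
    have h2 := finrank_inf_le_of_le y hu.1
    rcases Nat.eq_or_lt_of_le h2 with h | h
    · exact Or.inr ⟨⟨⟨x, a⟩, b⟩, ⟨⟨x', c⟩, d⟩, ⟨hu, by omega⟩, ⟨hv, by omega⟩⟩
    · exact Or.inl ⟨⟨hu, by omega⟩, ⟨hv, by omega⟩⟩
  · rintro (⟨⟨⟨_, a⟩, b⟩, ⟨⟨_, c⟩, d⟩⟩ | h)
    · have hc : Covers v (u ⊔ v) := ⟨le_sup_right, by omega⟩
      have := finrank_inf_le_of_covers y hc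
      exact ⟨⟨⟨le_sup_left, by omega⟩, by omega⟩, hc, by omega⟩
    · exact ⟨h.1, h.2.1⟩

theorem card_mem_sdiff [Fintype F] [Fintype V] {A B : Submodule F V}
    (h : A ≤ B) :
    ((Finset.univ.filter fun x : V => x ∈ B ∧ x ∉ A).card : ℂ) =
      (Fintype.card F : ℂ) ^ Module.finrank F ↥B - (Fintype.card F : ℂ) ^ Module.finrank F ↥A := by
  have hc (C : Submodule F V) : (Finset.univ.filter fun x : V => x ∈ C).card =
      Fintype.card F ^ Module.finrank F ↥C := by
    rw [← Module.card_eq_pow_finrank (K := F) (V := ↥C), Fintype.card_subtype]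
  have h1 : (Finset.univ.filter fun x : V => x ∈ B ∧ x ∉ A) =
      (Finset.univ.filter fun x : V => x ∈ B) \ (Finset.univ.filter fun x : V => x ∈ A) := by
    ext x; simp
  have h2 : (Finset.univ.filter fun x : V => x ∈ A) ⊆ Finset.univ.filter fun x : V => x ∈ B := by
    intro x; simp only [Finset.mem_filter_univ]; exact fun hx => h hx
  rw [h1, Finset.card_sdiff_of_subset h2, Nat.cast_sub (Finset.card_le_card h2), hc, hc]
  push_cast
  rfl

/-- Counting the subspaces of `B` covering `A` whose intersection with `C` is just `A`. -/
theorem card_covers_inf_eq [FiniteDimensional F V] [Fintype F] [Fintype (Submodule F V)]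
    {A B C : Submodule F V} (hAC : A ≤ C) (hCB : C ≤ B) :
    ((Finset.univ.filter fun w => Covers A w ∧ w ≤ B ∧ w ⊓ C = A).card : ℂ) *
      ((Fintype.card F : ℂ) ^ (Module.finrank F ↥A + 1) -
        (Fintype.card F : ℂ) ^ Module.finrank F ↥A) =
      (Fintype.card F : ℂ) ^ Module.finrank F ↥B - (Fintype.card F : ℂ) ^ Module.finrank F ↥C := by
  have : Finite V := Module.finite_of_finite F
  have : Fintype V := Fintype.ofFinite V
  have hrank {x : V} (hx : x ∉ A) : Covers A (A ⊔ F ∙ x) := by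
    refine ⟨le_sup_left, ?_⟩
    have h := Submodule.finrank_sup_add_finrank_inf_eq A (F ∙ x)
    have h0 : A ⊓ F ∙ x = ⊥ :=
      (Submodule.disjoint_span_singleton_of_notMem hx).eq_bot
    have hx0 : x ≠ 0 := fun h => hx (h ▸ A.zero_mem)
    rw [h0, finrank_bot, finrank_span_singleton hx0] at h
    omega
  rw [← card_mem_sdiff hCB, Finset.card_eq_sum_card_fiberwise (f := fun x => A ⊔ F ∙ x)
    (t := Finset.univ.filter fun w => Covers A w ∧ w ≤ B ∧ w ⊓ C = A)]
  · push_cast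
    rw [Finset.sum_congr rfl (g := fun _ => (Fintype.card F : ℂ) ^ (Module.finrank F ↥A + 1) -
        (Fintype.card F : ℂ) ^ Module.finrank F ↥A)]
    · rw [Finset.sum_const, nsmul_eq_mul]
    · intro w hw
      simp only [Finset.mem_filter_univ] at hw
      obtain ⟨hA, hB, hC⟩ := hw
      rw [← hA.2, ← card_mem_sdiff hA.1, Finset.filter_filter]
      congr 2
      ext x
      simp only [Finset.mem_filter_univ]
      constructor
      · rintro ⟨⟨_, h2⟩, rfl⟩
        exact ⟨Submodule.mem_sup_right (Submodule.mem_span_singleton_self x), fun h => h2 (hAC h)⟩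
      · rintro ⟨h1, h2⟩
        refine ⟨⟨hB h1, fun h => h2 (hC ▸ ⟨h1, h⟩)⟩, ?_⟩
        refine Submodule.eq_of_le_of_finrank_le
          (sup_le hA.1 ((Submodule.span_singleton_le_iff_mem _ _).2 h1)) ?_
        rw [(hrank h2).2, hA.2]
  · intro x hx
    simp only [Finset.coe_filter, Finset.mem_univ, true_and, Set.mem_ofPred_eq] at hx ⊢
    refine ⟨hrank fun h => hx.2 (hAC h), sup_le (hAC.trans hCB)
      ((Submodule.span_singleton_le_iff_mem _ _).2 hx.1), ?_⟩
    rw [sup_inf_assoc_of_le _ hAC, inf_comm,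
      (Submodule.disjoint_span_singleton_of_notMem hx.2).eq_bot, sup_bot_eq]

theorem slashCovers_iff_inf_sup_eq [FiniteDimensional F V] (y u w : Submodule F V) :
    SlashCovers y u w ↔ Covers u w ∧ w ≤ u ⊔ y ∧ w ⊓ u = u := by
  constructor
  · rintro ⟨h, h1⟩
    refine ⟨h, ?_, inf_eq_right.2 h.1⟩
    have h2 := Submodule.finrank_sup_add_finrank_inf_eq u (w ⊓ y)
    rw [← inf_assoc, inf_eq_left.2 h.1] at h2
    rw [← Submodule.eq_of_le_of_finrank_le (sup_le h.1 (inf_le_left : w ⊓ y ≤ w))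
      (by have := h.2; omega)]
    exact sup_le_sup_left inf_le_right u
  · rintro ⟨h, h1, -⟩
    refine ⟨h, ?_⟩
    have h2 := Submodule.finrank_sup_add_finrank_inf_eq u (w ⊓ y)
    rw [← inf_assoc, inf_eq_left.2 h.1] at h2
    have h3 : u ⊔ w ⊓ y = w := by
      rw [inf_comm, ← sup_inf_assoc_of_le _ h.1, inf_eq_right.2 h1]
    rw [h3] at h2
    have := h.2
    omega

theorem card_slashCovers_above [FiniteDimensional F V] [Fintype F] [Fintype (Submodule F V)]
    (y u : Submodule F V) :
    ((Finset.univ.filter fun w => SlashCovers y u w).card : ℂ) =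
      gaussC (Fintype.card F) (Module.finrank F ↥y - Module.finrank F ↥(u ⊓ y)) := by
  have h := card_covers_inf_eq (le_refl u) (le_sup_left : u ≤ u ⊔ y)
  simp only [← slashCovers_iff_inf_sup_eq] at h
  have hq1 : (Fintype.card F : ℂ) - 1 ≠ 0 :=
    sub_ne_zero.2 (by exact_mod_cast (Fintype.one_lt_card (α := F)).ne')
  have hq0 : (Fintype.card F : ℂ) ≠ 0 := by exact_mod_cast Fintype.card_ne_zero
  have hm := Submodule.finrank_sup_add_finrank_inf_eq u y
  have hle : Module.finrank F ↥(u ⊓ y) ≤ Module.finrank F ↥y :=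
    Submodule.finrank_mono inf_le_right
  have he : Module.finrank F ↥(u ⊔ y) = Module.finrank F ↥u +
      (Module.finrank F ↥y - Module.finrank F ↥(u ⊓ y)) := by omega
  rw [he, pow_add, pow_succ] at h
  rw [gaussC, eq_div_iff hq1]
  apply mul_left_cancel₀ (pow_ne_zero (Module.finrank F ↥u) hq0)
  linear_combination h

theorem covers_dualAnnihilator_iff [FiniteDimensional F V] (w u : Submodule F V) :
    Covers u.dualAnnihilator w.dualAnnihilator ↔ Covers w u := by
  have h1 := Subspace.finrank_add_finrank_dualAnnihilator_eq u
  have h2 := Subspace.finrank_add_finrank_dualAnnihilator_eq w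
  unfold Covers
  rw [Subspace.dualAnnihilator_le_dualAnnihilator_iff]
  constructor
  · rintro ⟨a, b⟩; exact ⟨a, by omega⟩
  · rintro ⟨a, b⟩; exact ⟨a, by omega⟩

theorem slashCovers_iff_sup_inf_eq [FiniteDimensional F V] (y w u : Submodule F V) :
    SlashCovers y w u ↔ Covers w u ∧ w ⊔ u ⊓ y = u := by
  unfold SlashCovers
  refine and_congr_right fun h => ?_
  have h2 := Submodule.finrank_sup_add_finrank_inf_eq w (u ⊓ y)
  rw [← inf_assoc, inf_eq_left.2 h.1] at h2
  have := h.2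
  constructor
  · intro h1
    exact Submodule.eq_of_le_of_finrank_le (sup_le h.1 inf_le_left) (by omega)
  · intro h1
    rw [h1] at h2
    omega

theorem card_slashCovers_below [FiniteDimensional F V] [Fintype F] [Fintype (Submodule F V)]
    (y u : Submodule F V) :
    ((Finset.univ.filter fun w => SlashCovers y w u).card : ℂ) =
      (Fintype.card F : ℂ) ^ (Module.finrank F ↥u - Module.finrank F ↥(u ⊓ y)) *
        gaussC (Fintype.card F) (Module.finrank F ↥(u ⊓ y)) := by
  have : Fintype (Submodule F (Module.Dual F V)) :=
    Fintype.ofEquiv _ (Subspace.orderIsoFiniteDimensional (K := F) (V := V)).toEquiv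
  have h := card_covers_inf_eq (F := F) (V := Module.Dual F V)
    (Submodule.dualAnnihilator_anti (inf_le_left : u ⊓ y ≤ u)) le_top
  have hcard : (Finset.univ.filter fun w => SlashCovers y w u).card =
      (Finset.univ.filter fun w : Submodule F (Module.Dual F V) =>
        Covers u.dualAnnihilator w ∧ w ≤ ⊤ ∧
          w ⊓ (u ⊓ y).dualAnnihilator = u.dualAnnihilator).card := by
    refine Finset.card_equiv (Subspace.orderIsoFiniteDimensional (K := F) (V := V)).toEquiv ?_
    intro w
    simp only [Finset.mem_filter_univ]
    change _ ↔ Covers u.dualAnnihilator w.dualAnnihilator ∧ w.dualAnnihilator ≤ ⊤ ∧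
      w.dualAnnihilator ⊓ (u ⊓ y).dualAnnihilator = u.dualAnnihilator
    rw [covers_dualAnnihilator_iff, ← Submodule.dualAnnihilator_sup_eq,
      Subspace.dualAnnihilator_inj, slashCovers_iff_sup_inf_eq]
    simp
  rw [← hcard] at h
  have hq1 : (Fintype.card F : ℂ) - 1 ≠ 0 :=
    sub_ne_zero.2 (by exact_mod_cast (Fintype.one_lt_card (α := F)).ne')
  have hq0 : (Fintype.card F : ℂ) ≠ 0 := by exact_mod_cast Fintype.card_ne_zero
  have h1 := Subspace.finrank_add_finrank_dualAnnihilator_eq u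
  have h2 := Subspace.finrank_add_finrank_dualAnnihilator_eq (u ⊓ y)
  have hle : Module.finrank F ↥(u ⊓ y) ≤ Module.finrank F ↥u :=
    Submodule.finrank_mono inf_le_left
  have e1 : Module.finrank F ↥(u ⊓ y).dualAnnihilator =
    Module.finrank F ↥u.dualAnnihilator +
      (Module.finrank F ↥u - Module.finrank F ↥(u ⊓ y)) := by omega
  have e2 : Module.finrank F ↥(⊤ : Submodule F (Module.Dual F V)) =
    Module.finrank F ↥u.dualAnnihilator +
      (Module.finrank F ↥u - Module.finrank F ↥(u ⊓ y)) + Module.finrank F ↥(u ⊓ y) := by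
    rw [finrank_top, Subspace.dual_finrank_eq]; omega
  rw [e1, e2, pow_add, pow_add, pow_succ] at h
  rw [gaussC, ← mul_div_assoc, eq_div_iff hq1]
  apply mul_left_cancel₀ (pow_ne_zero (Module.finrank F ↥u.dualAnnihilator) hq0)
  linear_combination h

theorem sum_ite_mul_ite {ι : Type*} [Fintype ι] (a b : ι → Prop) :
    ∑ w, (if a w then (1 : ℂ) else 0) * (if b w then (1 : ℂ) else 0) =
      ((Finset.univ.filter fun w => a w ∧ b w).card : ℂ) := by
  rw [Finset.natCast_card_filter]
  refine Finset.sum_congr rfl fun w _ => ?_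
  rw [ite_zero_mul_ite_zero, one_mul]

theorem sum_ite_mul_ite_of_unique {ι : Type*} [Fintype ι] {a b : ι → Prop} (x : ι)
    (hx : ∀ w, a w → b w → w = x) :
    ∑ w, (if a w then (1 : ℂ) else 0) * (if b w then (1 : ℂ) else 0) =
      if a x ∧ b x then 1 else 0 := by
  rw [Finset.sum_eq_single x]
  · rw [ite_zero_mul_ite_zero, one_mul]
  · intro w _ hw
    rw [ite_zero_mul_ite_zero, if_neg fun h => hw (hx w h.1 h.2)]
  · simp

theorem slash_ne_backslash {y u v w : Submodule F V} (h1 : SlashCovers y w u)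
    (h2 : BackslashCovers y w v) : u ≠ v := by
  rintro rfl
  have := h1.2
  have := h2.2
  omega

theorem matR1_mul_matL2_comm [FiniteDimensional F V] [Fintype (Submodule F V)]
    (y : Submodule F V) : matR1 y * matL2 y = matL2 y * matR1 y := by
  ext u v
  simp only [Matrix.mul_apply, matR1, matL1, matL2, Matrix.transpose_apply, Matrix.of_apply]
  rw [sum_ite_mul_ite_of_unique (u ⊓ v), sum_ite_mul_ite_of_unique (u ⊔ v)]
  · simp only [slash_inf_and_backslash_inf_iff]
  · intro w h1 h2
    refine Covers.eq_sup ?_ h1.1 h2.1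
    rintro rfl
    have := h1.2
    have := h2.2
    omega
  · intro w h1 h2
    exact Covers.eq_inf (slash_ne_backslash h1 h2) h1.1 h2.1

theorem matFm_eq [FiniteDimensional F V] [Fintype F] [Fintype (Submodule F V)]
    (y : Submodule F V) :
    matFm y = matR1 y * matL1 y - Matrix.diagonal fun u : Submodule F V =>
      (Fintype.card F : ℂ) ^ (Module.finrank F ↥u - Module.finrank F ↥(u ⊓ y)) *
        gaussC (Fintype.card F) (Module.finrank F ↥(u ⊓ y)) := by
  ext u v
  simp only [Matrix.sub_apply, Matrix.mul_apply, matR1, matL1, matFm, Matrix.transpose_apply,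
    Matrix.of_apply]
  by_cases huv : u = v
  · subst huv
    rw [sum_ite_mul_ite, Matrix.diagonal_apply_eq, if_neg]
    · simp only [and_self]
      rw [card_slashCovers_below, sub_self]
    · rintro ⟨h, -⟩
      have := h.1.2
      rw [inf_idem] at this
      omega
  · rw [sum_ite_mul_ite_of_unique (u ⊓ v) fun w h1 h2 => Covers.eq_inf huv h1.1 h2.1,
      Matrix.diagonal_apply_ne _ huv, sub_zero]

theorem matFm_add_matF0_eq [FiniteDimensional F V] [Fintype F] [Fintype (Submodule F V)]
    (y : Submodule F V) :
    matFm y + matF0 y = matL1 y * matR1 y - Matrix.diagonal fun u : Submodule F V =>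
      gaussC (Fintype.card F) (Module.finrank F ↥y - Module.finrank F ↥(u ⊓ y)) := by
  ext u v
  simp only [Matrix.sub_apply, Matrix.add_apply, Matrix.mul_apply, matR1, matL1, matFm, matF0,
    Matrix.transpose_apply, Matrix.of_apply]
  by_cases huv : u = v
  · subst huv
    rw [sum_ite_mul_ite, Matrix.diagonal_apply_eq, if_neg, if_neg]
    · simp only [and_self]
      rw [card_slashCovers_above, sub_self, add_zero]
    · rintro ⟨h, -⟩
      have := h.1.2
      rw [sup_idem] at this
      omega
    · rintro ⟨h, -⟩
      have := h.1.2
      rw [inf_idem] at this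
      omega
  · rw [sum_ite_mul_ite_of_unique (u ⊔ v) fun w h1 h2 => Covers.eq_sup huv h1.1 h2.1,
      Matrix.diagonal_apply_ne _ huv, sub_zero]
    simp only [slash_sup_iff y u v]
    by_cases h1 : SlashCovers y (u ⊓ v) u ∧ SlashCovers y (u ⊓ v) v
    · rw [if_pos h1, if_neg, if_pos (Or.inl h1), add_zero]
      rintro ⟨-, -, h2, -⟩
      exact slash_ne_backslash h1.1 h2 rfl
    · simp only [h1, false_or, if_false, zero_add]

theorem matL2_mul_matL1 [FiniteDimensional F V] [Fintype F] [Fintype (Submodule F V)]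
    (y : Submodule F V) :
    matL2 y * matL1 y = (Fintype.card F : ℂ) • (matL1 y * matL2 y) := by
  ext u v
  simp only [Matrix.smul_apply, Matrix.mul_apply, matL1, matL2, Matrix.of_apply, smul_eq_mul]
  by_cases h : u ≤ v ∧ Module.finrank F ↥v = Module.finrank F ↥u + 2 ∧
      Module.finrank F ↥(v ⊓ y) = Module.finrank F ↥(u ⊓ y) + 1
  · obtain ⟨hle, hd, hi⟩ := h
    have hm := Submodule.finrank_sup_add_finrank_inf_eq u (v ⊓ y)
    rw [← inf_assoc, inf_eq_left.2 hle] at hm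
    have hCv : u ⊔ v ⊓ y ≤ v := sup_le hle inf_le_left
    have hy : (u ⊔ v ⊓ y) ⊓ y = v ⊓ y :=
      le_antisymm (inf_le_inf_right y hCv) (le_inf le_sup_right inf_le_right)
    have hq1 : (Fintype.card F : ℂ) - 1 ≠ 0 :=
      sub_ne_zero.2 (by exact_mod_cast (Fintype.one_lt_card (α := F)).ne')
    have hq0 : (Fintype.card F : ℂ) ≠ 0 := by exact_mod_cast Fintype.card_ne_zero
    rw [sum_ite_mul_ite, sum_ite_mul_ite_of_unique (u ⊔ v ⊓ y), if_pos, mul_one]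
    · have hc := card_covers_inf_eq (le_sup_left : u ≤ u ⊔ v ⊓ y) hCv
      have heq (w : Submodule F V) : (BackslashCovers y u w ∧ SlashCovers y w v) ↔
          (Covers u w ∧ w ≤ v ∧ w ⊓ (u ⊔ v ⊓ y) = u) := by
        constructor
        · rintro ⟨⟨h1, h2⟩, ⟨h3, -⟩⟩
          refine ⟨h1, h3.1, ?_⟩
          rw [inf_comm, sup_inf_assoc_of_le _ h1.1, inf_comm v y, inf_assoc, inf_eq_right.2 h3.1,
            inf_comm, ← Submodule.eq_of_le_of_finrank_le (inf_le_inf_right y h1.1) h2.le]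
          exact sup_eq_left.2 inf_le_left
        · rintro ⟨h1, h2, h3⟩
          have h4 : w ⊓ y = u ⊓ y := by
            refine le_antisymm (le_inf ?_ inf_le_right) (inf_le_inf_right y h1.1)
            calc w ⊓ y ≤ w ⊓ (u ⊔ v ⊓ y) :=
                  le_inf inf_le_left ((inf_le_inf_right y h2).trans le_sup_right)
              _ = u := h3
          have := h1.2
          exact ⟨⟨h1, by rw [h4]⟩, ⟨h2, by omega⟩, by rw [h4, hi]⟩
      simp only [heq]
      have hC : Module.finrank F ↥(u ⊔ v ⊓ y) = Module.finrank F ↥u + 1 := by omega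
      rw [hC, hd, pow_add _ _ 2, pow_succ] at hc
      apply mul_left_cancel₀ (pow_ne_zero (Module.finrank F ↥u) hq0)
      apply mul_right_cancel₀ hq1
      linear_combination hc
    · exact ⟨⟨⟨le_sup_left, by omega⟩, by rw [hy, hi]⟩, ⟨hCv, by omega⟩, by rw [hy]⟩
    · intro w h1 h2
      have h3 : w ⊓ y = v ⊓ y :=
        Submodule.eq_of_le_of_finrank_le (inf_le_inf_right y h2.1.1) h2.2.le
      refine (Submodule.eq_of_le_of_finrank_le
        (sup_le h1.1.1 (h3 ▸ inf_le_left)) ?_).symm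
      have := h1.1.2
      omega
  · rw [sum_ite_mul_ite, sum_ite_mul_ite, Finset.filter_false_of_mem, Finset.filter_false_of_mem]
    · simp
    · rintro w - ⟨h1, h2⟩
      have := h1.2; have := h2.2; have := h1.1.2; have := h2.1.2
      exact h ⟨h1.1.1.trans h2.1.1, by omega, by omega⟩
    · rintro w - ⟨h1, h2⟩
      have := h1.2; have := h2.2; have := h1.1.2; have := h2.1.2
      exact h ⟨h1.1.1.trans h2.1.1, by omega, by omega⟩

theorem finrank_inf_eq_of_matL_apply_ne_zero [Fintype (Submodule F V)] {y u v : Submodule F V}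
    (h : matL y u v ≠ 0) : Module.finrank F ↥(u ⊓ y) = Module.finrank F ↥(v ⊓ y) + 1 := by
  simp only [matL, Matrix.mul_apply, matR1, matL1, matL2, Matrix.transpose_apply,
    Matrix.of_apply] at h
  obtain ⟨w, -, hw⟩ := Finset.exists_ne_zero_of_sum_ne_zero h
  rw [ite_zero_mul_ite_zero, ite_ne_right_iff] at hw
  rw [hw.1.1.2, hw.1.2.2]

theorem qpow_mul_qpow {q : ℕ} (hq : q ≠ 0) {a b : ℝ} {m : ℕ} (h : a + b = m) :
    qpow q a * qpow q b = (q : ℂ) ^ m := by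
  have : (0 : ℝ) < q := by exact_mod_cast Nat.pos_of_ne_zero hq
  rw [qpow, qpow, ← Complex.ofReal_mul, ← Real.rpow_add this, h, Real.rpow_natCast]
  push_cast
  rfl

theorem matK1_inv {q : ℕ} (hq : q ≠ 0) (k : ℕ) [Fintype (Submodule F V)] (y : Submodule F V) :
    (matK1 q k y)⁻¹ = Matrix.diagonal fun u : Submodule F V =>
      qpow q ((Module.finrank F ↥(u ⊓ y) : ℝ) - (k : ℝ) / 2) := by
  refine Matrix.inv_eq_left_inv ?_
  rw [matK1, Matrix.diagonal_mul_diagonal, ← Matrix.diagonal_one]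
  congr 1
  ext u
  rw [qpow_mul_qpow hq (m := 0) (by push_cast; ring), pow_zero]

theorem statement5
    (q n k : ℕ) (hq : IsPrimePow q) (hkn : k < n) (hk : 1 ≤ k)
    (F V : Type) [Field F] [Fintype F] (hcard : Fintype.card F = q)
    [AddCommGroup V] [Module F V] [FiniteDimensional F V]
    (hdim : Module.finrank F V = n)
    [Fintype (Submodule F V)]
    (y : Submodule F V) (hy : Module.finrank F ↥y = k) :
    (q : ℂ) • (matFm y * matL y) - matL y * matFm y - matL y * matF0 y +
      (((q : ℂ) - 1)⁻¹ • (qpow q ((n : ℝ) / 2 + 1) • ((matK1 q k y)⁻¹ * matK2 q n k y)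
        - qpow q ((k : ℝ) / 2 + 1) • matK1 q k y
        - qpow q (((n : ℝ) - (k : ℝ)) / 2 + 1) • matK2 q n k y
        + (1 : Matrix (Submodule F V) (Submodule F V) ℂ))) * matL y = 0 := by
  have hq0 : q ≠ 0 := hq.ne_zero
  have hq1 : (q : ℂ) - 1 ≠ 0 := sub_ne_zero.2 (by exact_mod_cast hq.one_lt.ne')
  have hcancel : (q : ℂ) • (matR1 y * matL1 y * matL y) = matL y * (matL1 y * matR1 y) := by
    calc (q : ℂ) • (matR1 y * matL1 y * matL y)
        = matR1 y * ((q : ℂ) • (matL1 y * matL2 y)) * matR1 y := by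
          rw [matL, matR1_mul_matL2_comm]
          simp only [Matrix.mul_smul, Matrix.smul_mul, Matrix.mul_assoc]
      _ = matL y * (matL1 y * matR1 y) := by
          rw [← hcard, ← matL2_mul_matL1, matL]
          simp only [Matrix.mul_assoc]
  have hdiag : ((q : ℂ) - 1)⁻¹ • (qpow q ((n : ℝ) / 2 + 1) • ((matK1 q k y)⁻¹ * matK2 q n k y)
        - qpow q ((k : ℝ) / 2 + 1) • matK1 q k y
        - qpow q (((n : ℝ) - (k : ℝ)) / 2 + 1) • matK2 q n k y
        + (1 : Matrix (Submodule F V) (Submodule F V) ℂ)) =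
      Matrix.diagonal fun u : Submodule F V => ((q : ℂ) - 1)⁻¹ *
        ((q : ℂ) ^ (Module.finrank F ↥u + 1) -
          (q : ℂ) ^ (k - Module.finrank F ↥(u ⊓ y) + 1) -
          (q : ℂ) ^ (Module.finrank F ↥u - Module.finrank F ↥(u ⊓ y) + 1) + 1) := by
    rw [matK1_inv hq0, matK1, matK2, Matrix.diagonal_mul_diagonal, ← Matrix.diagonal_one]
    simp only [← Matrix.diagonal_smul, Matrix.diagonal_sub, Matrix.diagonal_add]
    congr 1
    ext u
    have hik : Module.finrank F ↥(u ⊓ y) ≤ k := hy ▸ Submodule.finrank_mono inf_le_right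
    have hid : Module.finrank F ↥(u ⊓ y) ≤ Module.finrank F ↥u :=
      Submodule.finrank_mono inf_le_left
    have hb (a b c : ℝ) : qpow q (a - b) * qpow q c = qpow q (a - b + c) := by
      have : (0 : ℝ) < q := by exact_mod_cast Nat.pos_of_ne_zero hq0
      rw [qpow, qpow, qpow, ← Complex.ofReal_mul, ← Real.rpow_add this]
    simp only [Pi.smul_apply, smul_eq_mul]
    rw [hb, qpow_mul_qpow hq0 (m := Module.finrank F ↥u + 1) (by push_cast; ring),
      qpow_mul_qpow hq0 (m := k - Module.finrank F ↥(u ⊓ y) + 1)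
        (by push_cast [Nat.cast_sub hik]; ring),
      qpow_mul_qpow hq0 (m := Module.finrank F ↥u - Module.finrank F ↥(u ⊓ y) + 1)
        (by push_cast [Nat.cast_sub hid]; ring)]
  rw [hdiag, sub_sub, ← mul_add, matFm_add_matF0_eq, matFm_eq, hcard, hy, Matrix.sub_mul,
    Matrix.mul_sub, smul_sub, hcancel]
  ext u v
  simp only [Matrix.add_apply, Matrix.sub_apply, Matrix.smul_apply, Matrix.diagonal_mul,
    Matrix.mul_diagonal, smul_eq_mul, Matrix.zero_apply]
  by_cases hL : matL y u v = 0
  · simp [hL]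
  · have hi := finrank_inf_eq_of_matL_apply_ne_zero hL
    have hik : Module.finrank F ↥(u ⊓ y) ≤ k := hy ▸ Submodule.finrank_mono inf_le_right
    have hid : Module.finrank F ↥(u ⊓ y) ≤ Module.finrank F ↥u :=
      Submodule.finrank_mono inf_le_left
    have e1 : k - Module.finrank F ↥(v ⊓ y) = k - Module.finrank F ↥(u ⊓ y) + 1 := by omega
    have e2 : (q : ℂ) ^ (Module.finrank F ↥u + 1) =
        (q : ℂ) ^ (Module.finrank F ↥u - Module.finrank F ↥(u ⊓ y)) *
          (q : ℂ) ^ Module.finrank F ↥(u ⊓ y) * q := by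
      rw [← pow_add, ← pow_succ]
      congr 1
      omega
    rw [e1, e2, gaussC, gaussC]
    field_simp
    ring
end
end

section
/- Let w ∈ B_xy. Then: the number of z ∈ B_xy adjacent to w such that the edge wz has type 0 equals 2q^{i+1} − q − 1; the number of z ∈ B_xy adjacent to w such that the edge wz has type + equals q^{i+2}·[n−k−i−1]; and the number of z ∈ B_xy adjacent to w such that the edge wz has type − equals q^{i+2}·[k−i−1]. -/
open scoped Classical

noncomputable section

variable {F V : Type} [Field F] [AddCommGroup V] [Module F V]

lemma finrank_sup_add_inf [FiniteDimensional F V] (a b : Submodule F V) :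
    Module.finrank F ↥(a ⊔ b) + Module.finrank F ↥(a ⊓ b) =
      Module.finrank F ↥a + Module.finrank F ↥b :=
  Submodule.finrank_sup_add_finrank_inf_eq a b

lemma finrank_lt_of_le_of_not_le [FiniteDimensional F V] {a b : Submodule F V} (h : a ≤ b)
    (h' : ¬ b ≤ a) : Module.finrank F ↥a < Module.finrank F ↥b :=
  Submodule.finrank_lt_finrank_of_lt (lt_of_le_not_ge h h')

/-- The number of one-dimensional extensions of `U` inside `T` that do not lie in `Y`. -/
lemma ncard_covers_not_le_mul [Fintype F] [FiniteDimensional F V] {U Y T : Submodule F V}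
    (hUY : U ≤ Y) (hYT : Y ≤ T) :
    {z : Submodule F V | Module.finrank F ↥z = Module.finrank F ↥U + 1 ∧ U ≤ z ∧ z ≤ T ∧
        ¬ z ≤ Y}.ncard *
      (Fintype.card F ^ (Module.finrank F ↥U + 1) - Fintype.card F ^ Module.finrank F ↥U) =
    Fintype.card F ^ Module.finrank F ↥T - Fintype.card F ^ Module.finrank F ↥Y := by
  have hV : Finite V := Module.finite_of_finite F
  have : Fintype V := Fintype.ofFinite V
  have hP : Finite (Submodule F V) := inferInstance
  have : Fintype (Submodule F V) := Fintype.ofFinite _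
  have hdiff : ∀ A B : Submodule F V, A ≤ B →
      (Finset.univ.filter fun v : V => v ∈ B ∧ v ∉ A).card =
        Fintype.card F ^ Module.finrank F ↥B - Fintype.card F ^ Module.finrank F ↥A := by
    intro A B hAB
    have hc : ∀ C : Submodule F V, (Finset.univ.filter fun v : V => v ∈ C).card =
        Fintype.card F ^ Module.finrank F ↥C := by
      intro C
      rw [← Module.card_eq_pow_finrank (K := F) (V := C), Fintype.card_subtype]
    rw [← hc A, ← hc B, ← Finset.card_sdiff_of_subset]
    · congr 1
      ext v
      simp
    · intro v hv
      simp only [Finset.mem_filter, Finset.mem_univ, true_and] at hv ⊢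
      exact hAB hv
  rw [← hdiff Y T hYT, Set.ncard_eq_toFinset_card', eq_comm]
  rw [Finset.card_eq_sum_card_fiberwise (f := fun v => U ⊔ Submodule.span F {v})
    (t := {z : Submodule F V | Module.finrank F ↥z = Module.finrank F ↥U + 1 ∧ U ≤ z ∧ z ≤ T ∧
        ¬ z ≤ Y}.toFinset)]
  · apply Finset.sum_const_nat
    intro z hz
    simp only [Set.mem_toFinset, Set.mem_ofPred_eq] at hz
    obtain ⟨hz, hUz, hzT, hzY⟩ := hz
    rw [← hz, ← hdiff U z hUz]
    congr 1
    ext v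
    simp only [Finset.mem_filter, Finset.mem_univ, true_and]
    constructor
    · rintro ⟨⟨-, hvY⟩, rfl⟩
      exact ⟨Submodule.mem_sup_right (Submodule.mem_span_singleton_self v), fun h => hvY (hUY h)⟩
    · rintro ⟨hvz, hvU⟩
      have hle : U ⊔ Submodule.span F {v} ≤ z :=
        sup_le hUz ((Submodule.span_singleton_le_iff_mem v z).2 hvz)
      have heq : U ⊔ Submodule.span F {v} = z :=
        Submodule.eq_of_le_of_finrank_eq hle
          ((Submodule.finrank_sup_span_singleton hvU).trans hz.symm)
      refine ⟨⟨hzT hvz, fun hvY => hzY ?_⟩, heq⟩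
      rw [← heq]
      exact sup_le hUY ((Submodule.span_singleton_le_iff_mem v Y).2 hvY)
  · intro v hv
    simp only [Finset.coe_filter, Finset.mem_univ, true_and, Set.mem_ofPred_eq] at hv
    simp only [Set.coe_toFinset, Set.mem_ofPred_eq]
    refine ⟨Submodule.finrank_sup_span_singleton fun h => hv.2 (hUY h), le_sup_left,
      sup_le (hUY.trans hYT) ((Submodule.span_singleton_le_iff_mem v T).2 hv.1), fun h => ?_⟩
    exact hv.2 (h (Submodule.mem_sup_right (Submodule.mem_span_singleton_self v)))

/-- The number of one-dimensional extensions of `U` inside `T` that do not lie in `Y`. -/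
lemma ncard_covers_not_le [Fintype F] [FiniteDimensional F V] {U Y T : Submodule F V}
    (hUY : U ≤ Y) (hYT : Y ≤ T) {u a b : ℕ} (hu : Module.finrank F ↥U = u)
    (ha : Module.finrank F ↥Y = u + a) (hb : Module.finrank F ↥T = u + a + b) :
    ({z : Submodule F V | Module.finrank F ↥z = u + 1 ∧ U ≤ z ∧ z ≤ T ∧ ¬ z ≤ Y}.ncard : ℚ) =
      (Fintype.card F : ℚ) ^ a * gaussQ (Fintype.card F) b := by
  have h := ncard_covers_not_le_mul hUY hYT
  rw [hu, ha, hb] at h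
  have h1 : 1 < Fintype.card F := Fintype.one_lt_card
  have h1' : (1 : ℚ) < Fintype.card F := by exact_mod_cast h1
  have hs : (Fintype.card F : ℚ) - 1 ≠ 0 := by linarith
  have hp : (Fintype.card F : ℚ) ^ u ≠ 0 := by positivity
  have h' := congrArg (Nat.cast : ℕ → ℚ) h
  rw [Nat.cast_mul, Nat.cast_sub (Nat.pow_le_pow_right h1.le (by omega)),
    Nat.cast_sub (Nat.pow_le_pow_right h1.le (by omega))] at h'
  push_cast at h'
  rw [gaussQ, mul_div_assoc', eq_div_iff hs]
  apply mul_left_cancel₀ hp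
  linear_combination h'

/-- The number of hyperplanes of `S` that do not contain `E`. -/
lemma ncard_hyperplanes_not_ge [Fintype F] [FiniteDimensional F V] {D E S : Submodule F V}
    (hDE : D ≤ E) (hES : E ≤ S) {s a b : ℕ} (hs : Module.finrank F ↥S = s + 1)
    (ha : Module.finrank F ↥E + a = s + 1) (hb : Module.finrank F ↥D + b + a = s + 1) :
    ({z : Submodule F V | Module.finrank F ↥z = s ∧ z ≤ S ∧ D ≤ z ∧ ¬ E ≤ z}.ncard : ℚ) =
      (Fintype.card F : ℚ) ^ a * gaussQ (Fintype.card F) b := by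
  have hS := Subspace.finrank_add_finrank_dualAnnihilator_eq S
  have hE := Subspace.finrank_add_finrank_dualAnnihilator_eq E
  have hD := Subspace.finrank_add_finrank_dualAnnihilator_eq D
  rw [← ncard_covers_not_le (Submodule.dualAnnihilator_anti hES)
    (Submodule.dualAnnihilator_anti hDE) rfl (by omega) (by omega),
    ← Set.ncard_image_of_injective _
      (Subspace.orderIsoFiniteDimensional (K := F) (V := V)).injective]
  congr 2
  ext Z
  constructor
  · rintro ⟨z, ⟨hz, hzS, hDz, hEz⟩, rfl⟩
    have hzd := Subspace.finrank_add_finrank_dualAnnihilator_eq z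
    refine ⟨?_, Submodule.dualAnnihilator_anti hzS, Submodule.dualAnnihilator_anti hDz,
      fun h => hEz (Subspace.dualAnnihilator_le_dualAnnihilator_iff.1 h)⟩
    change Module.finrank F ↥z.dualAnnihilator = _
    omega
  · rintro ⟨hz, hzS, hDz, hEz⟩
    obtain ⟨z, rfl⟩ := (Subspace.orderIsoFiniteDimensional (K := F) (V := V)).surjective Z
    have hzd := Subspace.finrank_add_finrank_dualAnnihilator_eq z
    change Module.finrank F ↥z.dualAnnihilator = _ at hz
    refine ⟨z, ⟨by omega, Subspace.dualAnnihilator_le_dualAnnihilator_iff.1 hzS,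
      Subspace.dualAnnihilator_le_dualAnnihilator_iff.1 hDz,
      fun h => hEz (Submodule.dualAnnihilator_anti h)⟩, rfl⟩

lemma grass_adj_iff {k : ℕ} (hk : 1 ≤ k) (a b : GrassVertex F V k) :
    (Grass F V k).Adj a b ↔ Module.finrank F ↥(a.1 ⊓ b.1) + 1 = k := by
  rw [Grass, SimpleGraph.fromRel_adj, inf_comm b.1 a.1, or_self]
  constructor
  · rintro ⟨-, h⟩
    omega
  · intro h
    refine ⟨?_, by omega⟩
    rintro rfl
    rw [inf_idem, a.2] at h
    omega

lemma finrank_inf_add_length_le [FiniteDimensional F V] {k : ℕ} (hk : 1 ≤ k)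
    {x y : GrassVertex F V k} (p : (Grass F V k).Walk x y) :
    k ≤ Module.finrank F ↥(x.1 ⊓ y.1) + p.length := by
  induction p with
  | @nil a => rw [inf_idem, a.2]; omega
  | @cons a b c h p ih =>
    rw [grass_adj_iff hk] at h
    have h1 := finrank_sup_add_inf (a.1 ⊓ b.1) (b.1 ⊓ c.1)
    have h2 : Module.finrank F ↥((a.1 ⊓ b.1) ⊔ (b.1 ⊓ c.1)) ≤ Module.finrank F ↥b.1 :=
      Submodule.finrank_mono (sup_le inf_le_right inf_le_left)
    have h3 : Module.finrank F ↥((a.1 ⊓ b.1) ⊓ (b.1 ⊓ c.1)) ≤ Module.finrank F ↥(a.1 ⊓ c.1) :=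
      Submodule.finrank_mono
        (le_inf (inf_le_left.trans inf_le_left) (inf_le_right.trans inf_le_right))
    have h4 := b.2
    rw [SimpleGraph.Walk.length_cons]
    omega

lemma exists_walk_length_eq [FiniteDimensional F V] {k : ℕ} (hk : 1 ≤ k) (y : GrassVertex F V k)
    (d : ℕ) : ∀ x : GrassVertex F V k, Module.finrank F ↥(x.1 ⊓ y.1) + d = k →
      ∃ p : (Grass F V k).Walk x y, p.length = d := by
  induction d with
  | zero =>
    intro x h
    have h1 : x.1 ⊓ y.1 = x.1 :=
      Submodule.eq_of_le_of_finrank_eq inf_le_left (by rw [x.2]; omega)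
    have h2 : x.1 ⊓ y.1 = y.1 :=
      Submodule.eq_of_le_of_finrank_eq inf_le_right (by rw [y.2]; omega)
    obtain rfl : x = y := Subtype.ext (h1.symm.trans h2)
    exact ⟨SimpleGraph.Walk.nil, rfl⟩
  | succ d ih =>
    intro x h
    have hx := x.2
    have hy := y.2
    have hlt : x.1 ⊓ y.1 < x.1 := by
      refine lt_of_le_of_ne inf_le_left fun h' => ?_
      rw [h'] at h
      omega
    obtain ⟨H, hH, hHx⟩ := exists_le_covBy_of_lt hlt
    obtain ⟨u, huy, hux⟩ : ∃ u ∈ y.1, u ∉ x.1 := by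
      by_contra! hc
      have h' : x.1 ⊓ y.1 = y.1 := inf_eq_right.2 hc
      rw [h'] at h
      omega
    have hHr : Module.finrank F ↥H + 1 = k := by
      obtain ⟨v, hvx, hvH⟩ := SetLike.exists_of_lt hHx.lt
      have hle : H ⊔ Submodule.span F {v} ≤ x.1 :=
        sup_le hHx.le ((Submodule.span_singleton_le_iff_mem v _).2 hvx)
      have heq : H ⊔ Submodule.span F {v} = x.1 := by
        refine (hHx.eq_or_eq le_sup_left hle).resolve_left fun h' => hvH ?_
        rw [← h']
        exact Submodule.mem_sup_right (Submodule.mem_span_singleton_self v)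
      rw [← Submodule.finrank_sup_span_singleton hvH, heq, hx]
    have huH : u ∉ H := fun h' => hux (hHx.le h')
    let z : GrassVertex F V k :=
      ⟨H ⊔ Submodule.span F {u}, by rw [Submodule.finrank_sup_span_singleton huH, hHr]⟩
    have huz : u ∈ z.1 := Submodule.mem_sup_right (Submodule.mem_span_singleton_self u)
    have hadj : (Grass F V k).Adj x z := by
      rw [grass_adj_iff hk]
      have h1 : Module.finrank F ↥H ≤ Module.finrank F ↥(x.1 ⊓ z.1) :=
        Submodule.finrank_mono (le_inf hHx.le le_sup_left)
      have h2 := finrank_lt_of_le_of_not_le (inf_le_right : x.1 ⊓ z.1 ≤ z.1)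
        fun h' => hux (h' huz).1
      have h3 := z.2
      omega
    have hzy : Module.finrank F ↥(x.1 ⊓ y.1) + 1 ≤ Module.finrank F ↥(z.1 ⊓ y.1) :=
      finrank_lt_of_le_of_not_le
        (le_inf (hH.trans le_sup_left) inf_le_right : x.1 ⊓ y.1 ≤ z.1 ⊓ y.1)
        fun h' => hux (h' ⟨huz, huy⟩).1
    have hxz := (grass_adj_iff hk x z).1 hadj
    have h1 := finrank_sup_add_inf (x.1 ⊓ z.1) (z.1 ⊓ y.1)
    have h2 : Module.finrank F ↥((x.1 ⊓ z.1) ⊔ (z.1 ⊓ y.1)) ≤ Module.finrank F ↥z.1 :=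
      Submodule.finrank_mono (sup_le inf_le_right inf_le_left)
    have h3 : Module.finrank F ↥((x.1 ⊓ z.1) ⊓ (z.1 ⊓ y.1)) ≤ Module.finrank F ↥(x.1 ⊓ y.1) :=
      Submodule.finrank_mono
        (le_inf (inf_le_left.trans inf_le_left) (inf_le_right.trans inf_le_right))
    have h4 := z.2
    obtain ⟨p, hp⟩ := ih z (by omega)
    exact ⟨SimpleGraph.Walk.cons hadj p, by rw [SimpleGraph.Walk.length_cons, hp]⟩

/-- The distance in the Grassmann graph is the codimension of the intersection. -/
lemma finrank_inf_add_dist [FiniteDimensional F V] {k : ℕ} (hk : 1 ≤ k)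
    (x y : GrassVertex F V k) :
    Module.finrank F ↥(x.1 ⊓ y.1) + (Grass F V k).dist x y = k := by
  have hle : Module.finrank F ↥(x.1 ⊓ y.1) ≤ k :=
    (Submodule.finrank_mono inf_le_left).trans x.2.le
  obtain ⟨p, hp⟩ := exists_walk_length_eq hk y (k - Module.finrank F ↥(x.1 ⊓ y.1)) x (by omega)
  obtain ⟨p', hp'⟩ := p.reachable.exists_walk_length_eq_dist
  have h1 := SimpleGraph.dist_le p
  have h2 := finrank_inf_add_length_le hk p'
  omega

/-- The `k`-dimensional subspaces `x` and `y` meet in codimension `i`, and `w` is a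
`k`-dimensional subspace adjacent to `x` that meets `y` in codimension `i + 1`. -/
structure OuterNeighbor (k i : ℕ) (x y w : Submodule F V) : Prop where
  finrank_x : Module.finrank F ↥x = k
  finrank_y : Module.finrank F ↥y = k
  finrank_w : Module.finrank F ↥w = k
  finrank_xw : Module.finrank F ↥(x ⊓ w) + 1 = k
  finrank_xy : Module.finrank F ↥(x ⊓ y) + i = k
  finrank_wy : Module.finrank F ↥(w ⊓ y) + (i + 1) = k

namespace OuterNeighbor

variable [FiniteDimensional F V] {k i : ℕ} {x y w z : Submodule F V}

lemma finrank_sup (h : OuterNeighbor k i x y w) : Module.finrank F ↥(x ⊔ w) = k + 1 := by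
  obtain ⟨hx, hy, hw, hxw, hxy, hwy⟩ := h
  have := finrank_sup_add_inf x w
  omega

lemma inf_le_left (h : OuterNeighbor k i x y w) : w ⊓ y ≤ x := by
  obtain ⟨hx, hy, hw, hxw, hxy, hwy⟩ := h
  have h1 := finrank_sup_add_inf (x ⊓ w) (x ⊓ y)
  have h2 : Module.finrank F ↥((x ⊓ w) ⊔ (x ⊓ y)) ≤ Module.finrank F ↥x :=
    Submodule.finrank_mono (sup_le _root_.inf_le_left _root_.inf_le_left)
  have h3 : (x ⊓ w) ⊓ (x ⊓ y) ≤ w ⊓ y :=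
    le_inf (_root_.inf_le_left.trans inf_le_right) (inf_le_right.trans inf_le_right)
  have h4 := Submodule.eq_of_le_of_finrank_le h3 (by omega)
  rw [← h4]
  exact _root_.inf_le_left.trans _root_.inf_le_left

lemma inf_inf_eq (h : OuterNeighbor k i x y w) : (x ⊓ w) ⊓ y = w ⊓ y := by
  rw [inf_assoc]
  exact inf_eq_right.2 h.inf_le_left

lemma sup_inf_eq (h : OuterNeighbor k i x y w) : (x ⊔ w) ⊓ y = x ⊓ y := by
  have hs := h.finrank_sup
  obtain ⟨hx, hy, hw, hxw, hxy, hwy⟩ := h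
  symm
  apply Submodule.eq_of_le_of_finrank_le (inf_le_inf_right y le_sup_left)
  have h1 := finrank_sup_add_inf w ((x ⊔ w) ⊓ y)
  have h2 : Module.finrank F ↥(w ⊔ ((x ⊔ w) ⊓ y)) ≤ Module.finrank F ↥(x ⊔ w) :=
    Submodule.finrank_mono (sup_le le_sup_right _root_.inf_le_left)
  have h3 : Module.finrank F ↥(w ⊓ ((x ⊔ w) ⊓ y)) ≤ Module.finrank F ↥(w ⊓ y) :=
    Submodule.finrank_mono (inf_le_inf_left w inf_le_right)
  omega

lemma inf_sup_inf_eq (h : OuterNeighbor k i x y w) : (x ⊓ w) ⊔ (x ⊓ y) = x := by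
  have hi := h.inf_inf_eq
  obtain ⟨hx, hy, hw, hxw, hxy, hwy⟩ := h
  apply Submodule.eq_of_le_of_finrank_le (sup_le _root_.inf_le_left _root_.inf_le_left)
  have h1 := finrank_sup_add_inf (x ⊓ w) (x ⊓ y)
  have h3 : Module.finrank F ↥((x ⊓ w) ⊓ (x ⊓ y)) ≤ Module.finrank F ↥((x ⊓ w) ⊓ y) :=
    Submodule.finrank_mono (inf_le_inf_left _ inf_le_right)
  rw [hi] at h3
  omega

lemma le_inf_sup (h : OuterNeighbor k i x y w) : x ≤ (x ⊓ w) ⊔ y := by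
  conv_lhs => rw [← h.inf_sup_inf_eq]
  exact sup_le_sup_left inf_le_right _

lemma sup_le_sup (h : OuterNeighbor k i x y w) : x ⊔ w ≤ w ⊔ y :=
  sup_le (h.le_inf_sup.trans (sup_le_sup_right inf_le_right y)) le_sup_left

lemma inf_sup_inf_sup_eq (h : OuterNeighbor k i x y w) : ((x ⊓ w) ⊔ y) ⊓ (x ⊔ w) = x := by
  rw [sup_inf_assoc_of_le y (_root_.inf_le_left.trans le_sup_left), inf_comm y, h.sup_inf_eq,
    h.inf_sup_inf_eq]

lemma finrank_inf_sup (h : OuterNeighbor k i x y w) :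
    Module.finrank F ↥((x ⊓ w) ⊔ y) = k + i := by
  have h1 := finrank_sup_add_inf (x ⊓ w) y
  rw [h.inf_inf_eq] at h1
  obtain ⟨hx, hy, hw, hxw, hxy, hwy⟩ := h
  omega

lemma finrank_sup_right (h : OuterNeighbor k i x y w) :
    Module.finrank F ↥(w ⊔ y) = k + i + 1 := by
  have h1 := finrank_sup_add_inf w y
  obtain ⟨hx, hy, hw, hxw, hxy, hwy⟩ := h
  omega

/-- A common neighbor of `x` and `w` contains their intersection or lies in their sum. -/
lemma inf_le_or_le_sup (h : OuterNeighbor k i x y w) (hz : Module.finrank F ↥z = k)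
    (hxz : Module.finrank F ↥(x ⊓ z) + 1 = k) (hwz : Module.finrank F ↥(w ⊓ z) + 1 = k) :
    x ⊓ w ≤ z ∨ z ≤ x ⊔ w := by
  obtain ⟨hx, hy, hw, hxw, hxy, hwy⟩ := h
  by_cases hle : x ⊓ z ≤ w ⊓ z
  · left
    have h1 : x ⊓ z = x ⊓ w :=
      Submodule.eq_of_le_of_finrank_le
        (le_inf _root_.inf_le_left (hle.trans _root_.inf_le_left)) (by omega)
    rw [← h1]
    exact inf_le_right
  · right
    have h1 : (w ⊓ z) ⊔ (x ⊓ z) = z := by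
      apply Submodule.eq_of_le_of_finrank_le (sup_le inf_le_right inf_le_right)
      have := finrank_lt_of_le_of_not_le (le_sup_left : w ⊓ z ≤ (w ⊓ z) ⊔ (x ⊓ z))
        fun h' => hle (le_sup_right.trans h')
      omega
    rw [← h1]
    exact sup_le (_root_.inf_le_left.trans le_sup_right) (_root_.inf_le_left.trans le_sup_left)

lemma finrank_inf_of_inf_le (h : OuterNeighbor k i x y w) (hz : Module.finrank F ↥z = k)
    (hle : x ⊓ w ≤ z) (hzx : ¬ z ≤ x) : Module.finrank F ↥(x ⊓ z) + 1 = k := by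
  have h1 : Module.finrank F ↥(x ⊓ w) ≤ Module.finrank F ↥(x ⊓ z) :=
    Submodule.finrank_mono (le_inf _root_.inf_le_left hle)
  have h2 := finrank_lt_of_le_of_not_le (inf_le_right : x ⊓ z ≤ z)
    fun h' => hzx (h'.trans _root_.inf_le_left)
  have := h.finrank_xw
  omega

lemma finrank_inf_of_le_sup (h : OuterNeighbor k i x y w) (hz : Module.finrank F ↥z = k)
    (hle : z ≤ x ⊔ w) {e : Submodule F V} (he : e ≤ x ⊔ w) (hze : ¬ e ≤ z) :
    Module.finrank F ↥(e ⊓ z) + 1 = Module.finrank F ↥e := by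
  have h1 := finrank_sup_add_inf e z
  have h2 : Module.finrank F ↥(e ⊔ z) ≤ Module.finrank F ↥(x ⊔ w) :=
    Submodule.finrank_mono (sup_le he hle)
  have h3 := finrank_lt_of_le_of_not_le (le_sup_right : z ≤ e ⊔ z)
    fun h' => hze (le_sup_left.trans h')
  have := h.finrank_sup
  omega

/-- Inside `w ⊔ z`, the subspace `w` is a hyperplane, so it absorbs `(w ⊔ z) ⊓ y` or spans
`w ⊔ z` together with it. -/
lemma sup_inf_le_or_eq (h : OuterNeighbor k i x y w) (hz : Module.finrank F ↥z = k)
    (hwz : Module.finrank F ↥(w ⊓ z) + 1 = k) :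
    (w ⊔ z) ⊓ y ≤ w ∨ w ⊔ ((w ⊔ z) ⊓ y) = w ⊔ z := by
  by_cases hle : (w ⊔ z) ⊓ y ≤ w
  · exact .inl hle
  · right
    apply Submodule.eq_of_le_of_finrank_le (sup_le le_sup_left _root_.inf_le_left)
    have h1 := finrank_lt_of_le_of_not_le (le_sup_left : w ≤ w ⊔ ((w ⊔ z) ⊓ y))
      fun h' => hle (le_sup_right.trans h')
    have h2 := finrank_sup_add_inf w z
    have := h.finrank_w
    omega

end OuterNeighbor

/-- `z` is a `k`-dimensional subspace adjacent to both `x` and `w` that meets `y` in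
codimension `i + 1`. -/
structure CommonOuterNeighbor (k i : ℕ) (x y w z : Submodule F V) : Prop where
  finrank_z : Module.finrank F ↥z = k
  finrank_xz : Module.finrank F ↥(x ⊓ z) + 1 = k
  finrank_wz : Module.finrank F ↥(w ⊓ z) + 1 = k
  finrank_zy : Module.finrank F ↥(z ⊓ y) + (i + 1) = k

namespace OuterNeighbor

variable [FiniteDimensional F V] {k i : ℕ} {x y w z : Submodule F V}

lemma typeP_iff (h : OuterNeighbor k i x y w) :
    CommonOuterNeighbor k i x y w z ∧
      Module.finrank F ↥((w ⊔ z) ⊓ y) = Module.finrank F ↥(w ⊓ y) ↔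
    Module.finrank F ↥z = k ∧ x ⊓ w ≤ z ∧ z ≤ ⊤ ∧ ¬ z ≤ w ⊔ y := by
  constructor
  · rintro ⟨⟨hz, hxz, hwz, hzy⟩, ht⟩
    have hwzr := finrank_sup_add_inf w z
    have hw := h.finrank_w
    refine ⟨hz, (h.inf_le_or_le_sup hz hxz hwz).resolve_right fun hle => ?_, le_top,
      fun hle => ?_⟩
    · have h1 : w ⊔ z = x ⊔ w :=
        Submodule.eq_of_le_of_finrank_le (sup_le le_sup_right hle)
          (by rw [h.finrank_sup]; omega)
      rw [h1, h.sup_inf_eq] at ht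
      have := h.finrank_xy
      have := h.finrank_wy
      omega
    · have h1 : w ⊓ y = (w ⊔ z) ⊓ y :=
        Submodule.eq_of_le_of_finrank_eq (inf_le_inf_right y le_sup_left) ht.symm
      have h2 : (w ⊔ y) ⊓ (w ⊔ z) = w := by
        rw [sup_inf_assoc_of_le y le_sup_left, inf_comm y, ← h1]
        exact sup_eq_left.2 _root_.inf_le_left
      have h3 : w ⊔ z ≤ w := (le_inf (sup_le le_sup_left hle) le_rfl).trans h2.le
      have := Submodule.finrank_mono h3
      omega
  · rintro ⟨hz, hle, -, hzy⟩
    have hxz := h.finrank_inf_of_inf_le hz hle fun h' =>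
      hzy (h'.trans (le_sup_left.trans h.sup_le_sup))
    have hwz : Module.finrank F ↥(w ⊓ z) + 1 = k := by
      have h1 : Module.finrank F ↥(x ⊓ w) ≤ Module.finrank F ↥(w ⊓ z) :=
        Submodule.finrank_mono (le_inf inf_le_right hle)
      have h2 := finrank_lt_of_le_of_not_le (inf_le_right : w ⊓ z ≤ z)
        fun h' => hzy ((h'.trans _root_.inf_le_left).trans le_sup_left)
      have := h.finrank_xw
      omega
    have h1 : (w ⊔ z) ⊓ y ≤ w :=
      (h.sup_inf_le_or_eq hz hwz).resolve_right fun h' =>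
        hzy ((le_sup_right.trans h'.ge).trans (sup_le_sup_left inf_le_right w))
    have h2 : (w ⊔ z) ⊓ y = w ⊓ y :=
      le_antisymm (le_inf h1 inf_le_right) (inf_le_inf_right y le_sup_left)
    have h3 : z ⊓ y = w ⊓ y := by
      apply le_antisymm ((inf_le_inf_right y le_sup_right).trans h2.le)
      rw [← h.inf_inf_eq]
      exact inf_le_inf_right y hle
    exact ⟨⟨hz, hxz, hwz, by rw [h3, h.finrank_wy]⟩, by rw [h2]⟩

lemma typeM_iff (h : OuterNeighbor k i x y w) :
    CommonOuterNeighbor k i x y w z ∧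
      Module.finrank F ↥(w ⊓ y) = Module.finrank F ↥((w ⊓ z) ⊓ y) + 1 ↔
    Module.finrank F ↥z = k ∧ z ≤ x ⊔ w ∧ ⊥ ≤ z ∧ ¬ w ⊓ y ≤ z := by
  constructor
  · rintro ⟨⟨hz, hxz, hwz, hzy⟩, ht⟩
    refine ⟨hz, (h.inf_le_or_le_sup hz hxz hwz).resolve_left fun hle => ?_, bot_le,
      fun hle => ?_⟩
    · have h1 : w ⊓ y ≤ (w ⊓ z) ⊓ y := by
        rw [← h.inf_inf_eq]
        exact inf_le_inf_right y (le_inf inf_le_right hle)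
      have := Submodule.finrank_mono h1
      omega
    · have h1 : w ⊓ y ≤ (w ⊓ z) ⊓ y :=
        le_inf (le_inf _root_.inf_le_left hle) inf_le_right
      have := Submodule.finrank_mono h1
      omega
  · rintro ⟨hz, hle, -, hzy⟩
    have hxz := h.finrank_inf_of_le_sup hz hle le_sup_left fun h' =>
      hzy (h.inf_le_left.trans h')
    have hwz := h.finrank_inf_of_le_sup hz hle le_sup_right fun h' =>
      hzy (_root_.inf_le_left.trans h')
    have hwyz := h.finrank_inf_of_le_sup hz hle (_root_.inf_le_left.trans le_sup_right) hzy
    have hxyz := h.finrank_inf_of_le_sup hz hle (_root_.inf_le_left.trans le_sup_left)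
      fun h' : x ⊓ y ≤ z => hzy ((le_inf h.inf_le_left inf_le_right).trans h')
    rw [inf_right_comm] at hwyz
    have h1 : x ⊓ y ⊓ z = z ⊓ y := by
      rw [← h.sup_inf_eq, inf_right_comm, inf_eq_right.2 hle]
    rw [h1] at hxyz
    have := h.finrank_xy
    exact ⟨⟨hz, hxz.trans h.finrank_x, hwz.trans h.finrank_w, by omega⟩, hwyz.symm⟩

lemma type0_iff (h : OuterNeighbor k i x y w) :
    CommonOuterNeighbor k i x y w z ∧
      Module.finrank F ↥((w ⊔ z) ⊓ y) = Module.finrank F ↥(w ⊓ y) + 1 ∧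
      Module.finrank F ↥(w ⊓ y) = Module.finrank F ↥((w ⊓ z) ⊓ y) ↔
    ((Module.finrank F ↥z = k ∧ x ⊓ w ≤ z ∧ z ≤ w ⊔ y ∧ ¬ z ≤ (x ⊓ w) ⊔ y) ∨
      (Module.finrank F ↥z = k ∧ z ≤ x ⊔ w ∧ w ⊓ y ≤ z ∧ ¬ x ⊓ y ≤ z)) ∧ z ≠ w := by
  have hwyx := h.finrank_wy
  have hxy := h.finrank_xy
  have hw := h.finrank_w
  constructor
  · rintro ⟨⟨hz, hxz, hwz, hzy⟩, ht, ht'⟩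
    have hzw : z ≠ w := by
      rintro rfl
      rw [inf_idem] at hwz
      omega
    refine ⟨?_, hzw⟩
    have h1 : (w ⊓ z) ⊓ y = w ⊓ y :=
      Submodule.eq_of_le_of_finrank_eq (inf_le_inf_right y _root_.inf_le_left) ht'.symm
    have hwyz : w ⊓ y ≤ z := h1.ge.trans (_root_.inf_le_left.trans inf_le_right)
    refine (h.inf_le_or_le_sup hz hxz hwz).imp (fun hle => ⟨hz, hle, ?_, fun h' => hzw ?_⟩)
      fun hle => ⟨hz, hle, hwyz, fun h' => ?_⟩
    · have h2 : w ⊔ ((w ⊔ z) ⊓ y) = w ⊔ z :=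
        (h.sup_inf_le_or_eq hz hwz).resolve_left fun h' => by
          have := Submodule.finrank_mono (le_inf h' inf_le_right : (w ⊔ z) ⊓ y ≤ w ⊓ y)
          omega
      exact (le_sup_right.trans h2.ge).trans (sup_le_sup_left inf_le_right w)
    · have h2 : w ⊓ y = z ⊓ y :=
        Submodule.eq_of_le_of_finrank_le (le_inf hwyz inf_le_right) (by omega)
      apply Submodule.eq_of_le_of_finrank_eq _ (hz.trans hw.symm)
      calc z = ((x ⊓ w) ⊔ y) ⊓ z := (inf_eq_right.2 h').symm
        _ = (x ⊓ w) ⊔ (w ⊓ y) := by rw [sup_inf_assoc_of_le y hle, inf_comm y, ← h2]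
        _ ≤ w := sup_le inf_le_right _root_.inf_le_left
    · have := Submodule.finrank_mono (le_inf h' inf_le_right : x ⊓ y ≤ z ⊓ y)
      omega
  · rintro ⟨⟨hz, hle, hzT, hzy⟩ | ⟨hz, hle, hwyz, hxyz⟩, hzw⟩
    · have hxz := h.finrank_inf_of_inf_le hz hle fun h' => hzy (h'.trans h.le_inf_sup)
      have hwz : Module.finrank F ↥(w ⊓ z) + 1 = k := by
        have h1 : Module.finrank F ↥(x ⊓ w) ≤ Module.finrank F ↥(w ⊓ z) :=
          Submodule.finrank_mono (le_inf inf_le_right hle)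
        have h2 := finrank_lt_of_le_of_not_le (inf_le_right : w ⊓ z ≤ z)
          fun h' => hzw (Submodule.eq_of_le_of_finrank_eq (h'.trans _root_.inf_le_left)
            (hz.trans hw.symm))
        have := h.finrank_xw
        omega
      have hzyH : z ⊓ y ≤ x ⊓ w := by
        by_contra hc
        have h1 : (x ⊓ w) ⊔ (z ⊓ y) = z := by
          apply Submodule.eq_of_le_of_finrank_le (sup_le hle _root_.inf_le_left)
          have := finrank_lt_of_le_of_not_le (le_sup_left : x ⊓ w ≤ (x ⊓ w) ⊔ (z ⊓ y))
            fun h' => hc (le_sup_right.trans h')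
          have := h.finrank_xw
          omega
        exact hzy (h1.ge.trans (sup_le_sup_left inf_le_right _))
      have h2 : z ⊓ y = w ⊓ y := by
        apply le_antisymm (le_inf (hzyH.trans inf_le_right) inf_le_right)
        rw [← h.inf_inf_eq]
        exact inf_le_inf_right y hle
      have h3 : w ⊔ ((w ⊔ z) ⊓ y) = w ⊔ z := by
        rw [inf_comm, ← sup_inf_assoc_of_le y le_sup_left]
        exact inf_eq_right.2 (sup_le le_sup_left hzT)
      have h4 := finrank_sup_add_inf w ((w ⊔ z) ⊓ y)
      rw [h3, ← inf_assoc, inf_eq_left.2 (le_sup_left : w ≤ w ⊔ z)] at h4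
      have h5 := finrank_sup_add_inf w z
      refine ⟨⟨hz, hxz, hwz, by rw [h2, hwyx]⟩, by omega, ?_⟩
      rw [inf_assoc, h2, ← inf_assoc, inf_idem]
    · have hxz := h.finrank_inf_of_le_sup hz hle le_sup_left
        fun h' => hxyz (_root_.inf_le_left.trans h')
      have hwz := h.finrank_inf_of_le_sup hz hle le_sup_right
        fun h' => hzw (Submodule.eq_of_le_of_finrank_eq h' (hw.trans hz.symm)).symm
      have hxyz := h.finrank_inf_of_le_sup hz hle (_root_.inf_le_left.trans le_sup_left) hxyz
      have h1 : x ⊓ y ⊓ z = z ⊓ y := by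
        rw [← h.sup_inf_eq, inf_right_comm, inf_eq_right.2 hle]
      rw [h1] at hxyz
      have h2 : w ⊔ z = x ⊔ w := by
        apply Submodule.eq_of_le_of_finrank_le (sup_le le_sup_right hle)
        have := finrank_sup_add_inf w z
        rw [h.finrank_sup]
        omega
      refine ⟨⟨hz, hxz.trans h.finrank_x, hwz.trans hw, by omega⟩, ?_, ?_⟩
      · rw [h2, h.sup_inf_eq]
        omega
      · rw [inf_right_comm, inf_eq_left.2 hwyz]

lemma type0_inter_iff (h : OuterNeighbor k i x y w) (hz : Module.finrank F ↥z = k) :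
    (x ⊓ w ≤ z ∧ z ≤ w ⊔ y ∧ ¬ z ≤ (x ⊓ w) ⊔ y) ∧ (z ≤ x ⊔ w ∧ w ⊓ y ≤ z ∧ ¬ x ⊓ y ≤ z) ↔
      x ⊓ w ≤ z ∧ z ≤ x ⊔ w ∧ ¬ z ≤ x := by
  constructor
  · rintro ⟨⟨hle, -, hzy⟩, hle', -⟩
    exact ⟨hle, hle', fun h' => hzy (h'.trans h.le_inf_sup)⟩
  · rintro ⟨hle, hle', hzx⟩
    refine ⟨⟨hle, hle'.trans h.sup_le_sup, fun h' => hzx ?_⟩, hle', ?_, fun h' => hzx ?_⟩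
    · exact (le_inf h' hle').trans h.inf_sup_inf_sup_eq.le
    · exact (le_inf h.inf_le_left _root_.inf_le_left).trans hle
    · have h1 : x ≤ z := h.inf_sup_inf_eq.ge.trans (sup_le hle h')
      exact (Submodule.eq_of_le_of_finrank_eq h1 (h.finrank_x.trans hz.symm)).ge

variable [Fintype F]

lemma ncard_typeP (h : OuterNeighbor k i x y w) (hn : k + i + 1 ≤ Module.finrank F V) :
    ({z | CommonOuterNeighbor k i x y w z ∧
      Module.finrank F ↥((w ⊔ z) ⊓ y) = Module.finrank F ↥(w ⊓ y)}.ncard : ℚ) =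
    (Fintype.card F : ℚ) ^ (i + 2) *
      gaussQ (Fintype.card F) (Module.finrank F V - k - i - 1) := by
  have hxw := h.finrank_xw
  have := ncard_covers_not_le (inf_le_right.trans le_sup_left : x ⊓ w ≤ w ⊔ y) le_top
    (a := i + 2) (b := Module.finrank F V - k - i - 1) rfl
    (by rw [h.finrank_sup_right]; omega) (by rw [finrank_top]; omega)
  simp_rw [h.typeP_iff]
  rwa [hxw] at this

lemma ncard_typeM (h : OuterNeighbor k i x y w) :
    ({z | CommonOuterNeighbor k i x y w z ∧
      Module.finrank F ↥(w ⊓ y) = Module.finrank F ↥((w ⊓ z) ⊓ y) + 1}.ncard : ℚ) =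
    (Fintype.card F : ℚ) ^ (i + 2) * gaussQ (Fintype.card F) (k - i - 1) := by
  have hwy := h.finrank_wy
  simp_rw [h.typeM_iff]
  exact ncard_hyperplanes_not_ge bot_le (_root_.inf_le_left.trans le_sup_right) h.finrank_sup
    (by omega) (by rw [finrank_bot]; omega)

lemma ncard_type0 (h : OuterNeighbor k i x y w) :
    ({z | CommonOuterNeighbor k i x y w z ∧
      Module.finrank F ↥((w ⊔ z) ⊓ y) = Module.finrank F ↥(w ⊓ y) + 1 ∧
      Module.finrank F ↥(w ⊓ y) = Module.finrank F ↥((w ⊓ z) ⊓ y)}.ncard : ℚ) =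
    2 * (Fintype.card F : ℚ) ^ (i + 1) - Fintype.card F - 1 := by
  have hV : Finite V := Module.finite_of_finite F
  have hP : Finite (Submodule F V) := inferInstance
  have hxw := h.finrank_xw
  have hwy := h.finrank_wy
  have hxy := h.finrank_xy
  have hone : gaussQ (Fintype.card F) 1 = 1 := by
    have h1 : (1 : ℚ) < Fintype.card F := by exact_mod_cast Fintype.one_lt_card
    rw [gaussQ, pow_one, div_self (by linarith)]
  have hA := ncard_covers_not_le (le_sup_left : x ⊓ w ≤ (x ⊓ w) ⊔ y)
    (sup_le_sup_right inf_le_right y : (x ⊓ w) ⊔ y ≤ w ⊔ y) (a := i + 1) (b := 1) rfl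
    (by rw [h.finrank_inf_sup]; omega) (by rw [h.finrank_sup_right]; omega)
  have hB := ncard_hyperplanes_not_ge (le_inf h.inf_le_left inf_le_right : w ⊓ y ≤ x ⊓ y)
    (_root_.inf_le_left.trans le_sup_left) (a := i + 1) (b := 1) h.finrank_sup
    (by omega) (by omega)
  have hC := ncard_covers_not_le (_root_.inf_le_left : x ⊓ w ≤ x)
    (le_sup_left : x ≤ x ⊔ w) (a := 1) (b := 1) rfl
    (by rw [h.finrank_x]; omega) (by rw [h.finrank_sup]; omega)
  rw [hxw] at hA hC
  rw [hone, mul_one] at hA hB hC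
  rw [pow_one] at hC
  set A := {z : Submodule F V |
    Module.finrank F ↥z = k ∧ x ⊓ w ≤ z ∧ z ≤ w ⊔ y ∧ ¬ z ≤ (x ⊓ w) ⊔ y} with hAdef
  set B := {z : Submodule F V |
    Module.finrank F ↥z = k ∧ z ≤ x ⊔ w ∧ w ⊓ y ≤ z ∧ ¬ x ⊓ y ≤ z} with hBdef
  have hAB : A ∩ B = {z : Submodule F V |
      Module.finrank F ↥z = k ∧ x ⊓ w ≤ z ∧ z ≤ x ⊔ w ∧ ¬ z ≤ x} := by
    ext z
    constructor
    · rintro ⟨⟨hz, hzA⟩, -, hzB⟩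
      exact ⟨hz, (h.type0_inter_iff hz).1 ⟨hzA, hzB⟩⟩
    · rintro ⟨hz, hzC⟩
      have := (h.type0_inter_iff hz).2 hzC
      exact ⟨⟨hz, this.1⟩, hz, this.2⟩
  have hw : w ∈ A ∪ B := by
    right
    refine ⟨h.finrank_w, le_sup_right, _root_.inf_le_left, fun h' => ?_⟩
    have := Submodule.finrank_mono (le_inf h' inf_le_right : x ⊓ y ≤ w ⊓ y)
    omega
  have hset : {z | CommonOuterNeighbor k i x y w z ∧
      Module.finrank F ↥((w ⊔ z) ⊓ y) = Module.finrank F ↥(w ⊓ y) + 1 ∧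
      Module.finrank F ↥(w ⊓ y) = Module.finrank F ↥((w ⊓ z) ⊓ y)} = (A ∪ B) \ {w} := by
    ext z
    exact h.type0_iff
  have h1 := Set.ncard_union_add_ncard_inter A B
  have h2 := Set.ncard_sdiff_singleton_add_one hw
  rw [hAB] at h1
  rw [hset]
  have h1' := congrArg (Nat.cast : ℕ → ℚ) h1
  have h2' := congrArg (Nat.cast : ℕ → ℚ) h2
  push_cast at h1' h2'
  linarith

end OuterNeighbor

lemma mem_Bset_adj_iff [FiniteDimensional F V] {k i : ℕ} (hk : 1 ≤ k) {x y w z : GrassVertex F V k}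
    (hi : (Grass F V k).dist x y = i) :
    z ∈ Bset x y ∧ (Grass F V k).Adj w z ↔ CommonOuterNeighbor k i x.1 y.1 w.1 z.1 := by
  have hd := finrank_inf_add_dist hk z y
  simp only [Bset, Set.mem_ofPred_eq, grass_adj_iff hk, hi]
  constructor
  · rintro ⟨⟨h1, h2⟩, h3⟩
    exact ⟨z.2, h1, h3, by rw [← h2, hd]⟩
  · rintro ⟨-, h1, h3, h2⟩
    exact ⟨⟨h1, by omega⟩, h3⟩

lemma ncard_subtype_val_eq {k : ℕ} (P : Submodule F V → Prop)
    (hP : ∀ z, P z → Module.finrank F ↥z = k) :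
    {z : GrassVertex F V k | P z.1}.ncard = {z : Submodule F V | P z}.ncard := by
  rw [← Set.ncard_image_of_injective _ Subtype.val_injective]
  congr 1
  ext z
  constructor
  · rintro ⟨z, hz, rfl⟩
    exact hz
  · intro hz
    exact ⟨⟨z, hP z hz⟩, hz, rfl⟩

theorem statement8
    (q n k : ℕ) (hq : IsPrimePow q) (hkn : 2 * k < n) (hk : 3 ≤ k)
    (F V : Type) [Field F] [Fintype F] (hcard : Fintype.card F = q)
    [AddCommGroup V] [Module F V] [FiniteDimensional F V]
    (hdim : Module.finrank F V = n)
    [Fintype (Submodule F V)]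
    (x y : GrassVertex F V k)
    (i : ℕ) (hi : (Grass F V k).dist x y = i) (hi1 : 1 < i) (hi2 : i < k)
    (w : GrassVertex F V k) (hw : w ∈ Bset x y) :
    ({z | z ∈ Bset x y ∧ (Grass F V k).Adj w z ∧ EdgeType0 y w z}.ncard : ℚ) = 2 * (q : ℚ) ^ (i + 1) - q - 1 ∧
    ({z | z ∈ Bset x y ∧ (Grass F V k).Adj w z ∧ EdgeTypeP y w z}.ncard : ℚ) = (q : ℚ) ^ (i + 2) * gaussQ q (n - k - i - 1) ∧
    ({z | z ∈ Bset x y ∧ (Grass F V k).Adj w z ∧ EdgeTypeM y w z}.ncard : ℚ) = (q : ℚ) ^ (i + 2) * gaussQ q (k - i - 1) := by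
  subst hcard hdim
  have hk1 : 1 ≤ k := by omega
  have hxy := finrank_inf_add_dist hk1 x y
  have hwy := finrank_inf_add_dist hk1 w y
  rw [hw.2] at hwy
  rw [hi] at hxy hwy
  have h : OuterNeighbor k i x.1 y.1 w.1 :=
    ⟨x.2, y.2, w.2, (grass_adj_iff hk1 x w).1 hw.1, hxy, hwy⟩
  have hset (T : GrassVertex F V k → Prop) :
      {z | z ∈ Bset x y ∧ (Grass F V k).Adj w z ∧ T z} =
        {z | CommonOuterNeighbor k i x.1 y.1 w.1 z.1 ∧ T z} := by
    ext z
    exact and_assoc.symm.trans (and_congr_left' (mem_Bset_adj_iff hk1 hi))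
  simp only [hset]
  refine ⟨?_, ?_, ?_⟩
  · rw [← h.ncard_type0, ← ncard_subtype_val_eq _ fun z hz => hz.1.finrank_z]
    congr 3
    ext z
    refine and_congr_right fun hz => ⟨fun ht => ⟨ht.1.2, ht.2.2.1.2⟩, fun ht => ?_⟩
    have := finrank_sup_add_inf w.1 z.1
    obtain ⟨hz1, hz2, hz3, hz4⟩ := hz
    have := w.2
    exact ⟨⟨⟨le_sup_left, by omega⟩, ht.1⟩, ⟨⟨le_sup_right, by omega⟩, by omega⟩,
      ⟨⟨inf_le_left, by omega⟩, ht.2⟩, ⟨⟨inf_le_right, by omega⟩, by omega⟩⟩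
  · rw [← h.ncard_typeP (by omega), ← ncard_subtype_val_eq _ fun z hz => hz.1.finrank_z]
    congr 3
    ext z
    refine and_congr_right fun hz => ⟨fun ht => ht.1.2, fun ht => ?_⟩
    have := finrank_sup_add_inf w.1 z.1
    obtain ⟨hz1, hz2, hz3, hz4⟩ := hz
    have := w.2
    exact ⟨⟨⟨le_sup_left, by omega⟩, ht⟩, ⟨⟨le_sup_right, by omega⟩, by omega⟩⟩
  · rw [← h.ncard_typeM, ← ncard_subtype_val_eq _ fun z hz => hz.1.finrank_z]
    congr 3
    ext z
    refine and_congr_right fun hz => ⟨fun ht => ht.1.2, fun ht => ?_⟩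
    obtain ⟨hz1, hz2, hz3, hz4⟩ := hz
    have := w.2
    exact ⟨⟨⟨inf_le_left, by omega⟩, ht⟩, ⟨⟨inf_le_right, by omega⟩, by omega⟩⟩
end
end
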